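/- Let d ≥ 1, L > 0, λ ≥ max(1, L²), Δ_min > 0, and let x_1, …, x_T ∈ ℝ^d satisfy ‖x_t‖₂ ≤ L for all t. Set V_t = λ I_d + Σ_{s=1}^{t−1} x_s x_sᵀ, let 0 < α_1 ≤ … ≤ α_T be nondecreasing positive reals, and let B ⊆ {1, …, T} be a set of rounds such that for every t ∈ B there is a gap Δ_t with Δ_min ≤ Δ_t ≤ 2 α_t ‖x_t‖_{V_t⁻¹}. Then |B| ≤ (2 α_T / Δ_min) · √( 2 d T log( 1 + T L² / (d λ) ) ). -/

import Mathlib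

open Matrix Real

/-- The weighted norm `‖z‖_M = √(zᵀ M z)` of a vector with respect to a matrix `M`. -/
noncomputable def wnorm {d : ℕ} (M : Matrix (Fin d) (Fin d) ℝ) (z : Fin d → ℝ) : ℝ :=
  Real.sqrt (z ⬝ᵥ M.mulVec z)

/-- The Euclidean norm `‖z‖₂ = √(zᵀ z)`. -/
noncomputable def l2norm {d : ℕ} (z : Fin d → ℝ) : ℝ :=
  Real.sqrt (z ⬝ᵥ z)

/-- The matrix determinant lemma for a rank-one update `A + v vᵀ`. -/
theorem det_add_vecMulVec_self {d : ℕ} {A : Matrix (Fin d) (Fin d) ℝ} (hA : IsUnit A.det)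
    (v : Fin d → ℝ) :
    (A + vecMulVec v v).det = A.det * (1 + v ⬝ᵥ A⁻¹ *ᵥ v) := by
  rw [vecMulVec_eq Unit, det_add_replicateCol_mul_replicateRow hA, Matrix.mul_assoc,
    ← replicateCol_mulVec, det_unique (n := Unit), Matrix.add_apply, Matrix.one_apply_eq,
    replicateRow_mul_replicateCol_apply]

/-- The tangent-line form of the AM-GM bound on the determinant of a positive definite matrix. -/
theorem log_det_le_of_trace_le {d : ℕ} {A : Matrix (Fin d) (Fin d) ℝ} (hA : A.PosDef) {c : ℝ}
    (hc : 0 < c) (htr : A.trace ≤ d * c) : Real.log A.det ≤ d * Real.log c := by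
  have hdet : A.det = ∏ i, hA.isHermitian.eigenvalues i :=
    hA.isHermitian.det_eq_prod_eigenvalues
  have htrace : A.trace = ∑ i, hA.isHermitian.eigenvalues i :=
    hA.isHermitian.trace_eq_sum_eigenvalues
  have hpos := hA.eigenvalues_pos
  rw [hdet, Real.log_prod fun i _ => (hpos i).ne']
  calc ∑ i, Real.log (hA.isHermitian.eigenvalues i)
      ≤ ∑ i, (Real.log c + (hA.isHermitian.eigenvalues i / c - 1)) := by
        refine Finset.sum_le_sum fun i _ => ?_
        have h := Real.log_le_sub_one_of_pos (div_pos (hpos i) hc)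
        rw [Real.log_div (hpos i).ne' hc.ne'] at h
        linarith
    _ = d * Real.log c + (A.trace / c - d) := by
        simp [Finset.sum_add_distrib, ← Finset.sum_div, htrace]
    _ ≤ d * Real.log c := by
        have := (div_le_iff₀ hc).2 htr
        linarith

theorem le_two_mul_log_one_add {u : ℝ} (h0 : 0 ≤ u) (h1 : u ≤ 1) :
    u ≤ 2 * Real.log (1 + u) := by
  have h := Real.one_sub_inv_le_log_of_pos (by linarith : 0 < 1 + u)
  have h2 : u / 2 ≤ 1 - (1 + u)⁻¹ := by
    rw [show 1 - (1 + u)⁻¹ = u / (1 + u) by field_simp; ring]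
    gcongr
    linarith
  linarith

/-- If `A` dominates `lam • 1` and `v ⬝ᵥ v ≤ lam`, then `vᵀ A⁻¹ v ≤ 1`. -/
theorem dotProduct_inv_mulVec_le_one {d : ℕ} {A : Matrix (Fin d) (Fin d) ℝ} (hA : IsUnit A.det)
    {lam : ℝ} (hdom : ∀ y, lam * (y ⬝ᵥ y) ≤ y ⬝ᵥ A *ᵥ y) {v : Fin d → ℝ}
    (hv : v ⬝ᵥ v ≤ lam) : v ⬝ᵥ A⁻¹ *ᵥ v ≤ 1 := by
  set y := A⁻¹ *ᵥ v with hy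
  have hAy : A *ᵥ y = v := by rw [hy, mulVec_mulVec, mul_nonsing_inv _ hA, one_mulVec]
  have h1 := hdom y
  rw [hAy, dotProduct_comm] at h1
  have hyy : 0 ≤ y ⬝ᵥ y := Finset.sum_nonneg fun i _ => mul_self_nonneg _
  have hcs : (v ⬝ᵥ y) ^ 2 ≤ (v ⬝ᵥ v) * (y ⬝ᵥ y) := by
    simpa [dotProduct, pow_two] using Finset.sum_mul_sq_le_sq_mul_sq Finset.univ v y
  have h2 : (v ⬝ᵥ v) * (y ⬝ᵥ y) ≤ lam * (y ⬝ᵥ y) := by gcongr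
  rw [dotProduct_comm y v] at h1
  nlinarith

/-- The regularized Gram matrix of the first `n` terms `x 1, …, x n`. -/
noncomputable def regGram {d : ℕ} (lam : ℝ) (x : ℕ → Fin d → ℝ) (n : ℕ) :
    Matrix (Fin d) (Fin d) ℝ :=
  lam • (1 : Matrix (Fin d) (Fin d) ℝ) + ∑ s ∈ Finset.Icc 1 n, vecMulVec (x s) (x s)

section regGram

variable {d : ℕ} {lam : ℝ} (x : ℕ → Fin d → ℝ)

theorem regGram_succ (n : ℕ) :
    regGram lam x (n + 1) = regGram lam x n + vecMulVec (x (n + 1)) (x (n + 1)) := by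
  rw [regGram, regGram, Finset.sum_Icc_succ_top (by omega), add_assoc]

theorem regGram_posDef (hlam : 0 < lam) (n : ℕ) : (regGram lam x n).PosDef := by
  refine (PosDef.one.smul hlam).add_posSemidef (posSemidef_sum _ fun s _ => ?_)
  simpa using posSemidef_vecMulVec_self_star (x s)

theorem mul_dotProduct_le_regGram (n : ℕ) (y : Fin d → ℝ) :
    lam * (y ⬝ᵥ y) ≤ y ⬝ᵥ regGram lam x n *ᵥ y := by
  have h : 0 ≤ y ⬝ᵥ (∑ s ∈ Finset.Icc 1 n, vecMulVec (x s) (x s)) *ᵥ y := by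
    have := (posSemidef_sum (Finset.Icc 1 n) fun s _ =>
      posSemidef_vecMulVec_self_star (x s)).dotProduct_mulVec_nonneg y
    simpa using this
  rw [regGram, add_mulVec, dotProduct_add, smul_mulVec, one_mulVec, dotProduct_smul, smul_eq_mul]
  linarith

theorem trace_regGram (n : ℕ) :
    (regGram lam x n).trace = d * lam + ∑ s ∈ Finset.Icc 1 n, x s ⬝ᵥ x s := by
  simp [regGram, trace_sum, trace_vecMulVec, mul_comm]

theorem log_det_regGram (hlam : 0 < lam) (n : ℕ) :
    Real.log (regGram lam x n).det = d * Real.log lam +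
      ∑ t ∈ Finset.Icc 1 n, Real.log (1 + x t ⬝ᵥ (regGram lam x (t - 1))⁻¹ *ᵥ x t) := by
  induction n with
  | zero => simp [regGram]
  | succ n ih =>
    have hpd := regGram_posDef x hlam n
    have hnn : 0 ≤ x (n + 1) ⬝ᵥ (regGram lam x n)⁻¹ *ᵥ x (n + 1) := by
      simpa using hpd.inv.posSemidef.dotProduct_mulVec_nonneg (x (n + 1))
    rw [regGram_succ, det_add_vecMulVec_self hpd.det_pos.ne'.isUnit,
      Real.log_mul hpd.det_pos.ne' (by positivity), ih, Finset.sum_Icc_succ_top (by omega),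
      Nat.add_sub_cancel, add_assoc]

/-- The elliptical potential lemma. -/
theorem sum_dotProduct_regGram_inv_le (hd : 1 ≤ d) {L : ℝ} (hlam : 0 < lam)
    (hL : L ^ 2 ≤ lam) (n : ℕ) (hx : ∀ t ∈ Finset.Icc 1 n, x t ⬝ᵥ x t ≤ L ^ 2) :
    ∑ t ∈ Finset.Icc 1 n, x t ⬝ᵥ (regGram lam x (t - 1))⁻¹ *ᵥ x t
      ≤ 2 * d * Real.log (1 + n * L ^ 2 / (d * lam)) := by
  have hd0 : (0 : ℝ) < d := by exact_mod_cast hd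
  have hsum : ∑ t ∈ Finset.Icc 1 n, x t ⬝ᵥ (regGram lam x (t - 1))⁻¹ *ᵥ x t
      ≤ 2 * ∑ t ∈ Finset.Icc 1 n,
        Real.log (1 + x t ⬝ᵥ (regGram lam x (t - 1))⁻¹ *ᵥ x t) := by
    rw [Finset.mul_sum]
    refine Finset.sum_le_sum fun t ht => ?_
    have hpd := regGram_posDef x hlam (t - 1)
    refine le_two_mul_log_one_add ?_ (dotProduct_inv_mulVec_le_one hpd.det_pos.ne'.isUnit
      (mul_dotProduct_le_regGram x (t - 1)) ((hx t ht).trans hL))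
    simpa using hpd.inv.posSemidef.dotProduct_mulVec_nonneg (x t)
  have hq : 0 ≤ n * L ^ 2 / (d * lam) := by positivity
  have hlog : Real.log (regGram lam x n).det
      ≤ d * Real.log (lam * (1 + n * L ^ 2 / (d * lam))) := by
    refine log_det_le_of_trace_le (regGram_posDef x hlam n) (by positivity) ?_
    have hs := Finset.sum_le_card_nsmul _ _ _ hx
    rw [Nat.card_Icc, Nat.add_sub_cancel, nsmul_eq_mul] at hs
    rw [trace_regGram, show d * (lam * (1 + n * L ^ 2 / (d * lam))) = d * lam + n * L ^ 2 by
      field_simp]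
    linarith
  rw [log_det_regGram x hlam, Real.log_mul hlam.ne' (by positivity)] at hlog
  linarith

end regGram

theorem stmt11 {d : ℕ} (hd : 1 ≤ d) (L lam Δmin : ℝ) (hL : 0 < L)
    (hlam : max 1 (L ^ 2) ≤ lam) (hΔ : 0 < Δmin) (T : ℕ)
    (x : ℕ → Fin d → ℝ) (hx : ∀ t ∈ Finset.Icc 1 T, l2norm (x t) ≤ L)
    (V : ℕ → Matrix (Fin d) (Fin d) ℝ)
    (hV : ∀ t, V t = lam • (1 : Matrix (Fin d) (Fin d) ℝ)
      + ∑ s ∈ Finset.Icc 1 (t - 1), Matrix.vecMulVec (x s) (x s))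
    (α : ℕ → ℝ)
    (hαpos : ∀ t ∈ Finset.Icc 1 T, 0 < α t)
    (hαmono : ∀ s ∈ Finset.Icc 1 T, ∀ t ∈ Finset.Icc 1 T, s ≤ t → α s ≤ α t)
    (B : Finset ℕ) (hB : B ⊆ Finset.Icc 1 T)
    (Δ : ℕ → ℝ)
    (hgap : ∀ t ∈ B, Δmin ≤ Δ t ∧ Δ t ≤ 2 * α t * wnorm (V t)⁻¹ (x t)) :
    (B.card : ℝ)
      ≤ (2 * α T / Δmin) * Real.sqrt (2 * d * T * Real.log (1 + T * L ^ 2 / (d * lam))) := by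
  have hlam0 : 0 < lam := lt_of_lt_of_le one_pos ((le_max_left _ _).trans hlam)
  have hVx : ∀ t, V t = regGram lam x (t - 1) := hV
  set u : ℕ → ℝ := fun t => x t ⬝ᵥ (regGram lam x (t - 1))⁻¹ *ᵥ x t with hu
  have hw : ∀ t, wnorm (V t)⁻¹ (x t) = √(u t) := fun t => by rw [wnorm, hVx]
  have hu0 : ∀ t, 0 ≤ u t := fun t => by
    simpa using (regGram_posDef x hlam0 (t - 1)).inv.posSemidef.dotProduct_mulVec_nonneg (x t)
  have hpot := sum_dotProduct_regGram_inv_le x hd hlam0 ((le_max_right _ _).trans hlam) T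
    fun t ht => (Real.sqrt_le_left hL.le).1 (hx t ht)
  have hαT : ∀ t ∈ B, α t ≤ α T ∧ 0 < α T := fun t ht => by
    have h := Finset.mem_Icc.1 (hB ht)
    have hT : T ∈ Finset.Icc 1 T := Finset.mem_Icc.2 ⟨h.1.trans h.2, le_rfl⟩
    exact ⟨hαmono t (hB ht) T hT h.2, hαpos T hT⟩
  rcases B.eq_empty_or_nonempty with rfl | ⟨b, hb⟩
  · rcases Nat.eq_zero_or_pos T with rfl | hT
    · simp
    · have := hαpos T (Finset.mem_Icc.2 ⟨hT, le_rfl⟩)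
      simp only [Finset.card_empty, Nat.cast_zero]
      positivity
  have hα0 : 0 < α T := (hαT b hb).2
  have hgaps : B.card * Δmin ≤ 2 * α T * ∑ t ∈ B, √(u t) := by
    rw [← nsmul_eq_mul, Finset.mul_sum]
    refine Finset.card_nsmul_le_sum _ _ _ fun t ht => (hgap t ht).1.trans ?_
    refine (hgap t ht).2.trans ?_
    rw [hw]
    have := (hαT t ht).1
    gcongr
  have hcs : ∑ t ∈ B, √(u t)
      ≤ √(2 * d * T * Real.log (1 + T * L ^ 2 / (d * lam))) := by
    refine Real.le_sqrt_of_sq_le (sq_sum_le_card_mul_sum_sq.trans ?_)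
    simp only [Real.sq_sqrt (hu0 _)]
    have hcard : (B.card : ℝ) ≤ T := by
      have := Finset.card_le_card hB
      rw [Nat.card_Icc, Nat.add_sub_cancel] at this
      exact_mod_cast this
    have hsub : ∑ t ∈ B, u t ≤ ∑ t ∈ Finset.Icc 1 T, u t :=
      Finset.sum_le_sum_of_subset_of_nonneg hB fun t _ _ => hu0 t
    calc B.card * ∑ t ∈ B, u t ≤ T * ∑ t ∈ Finset.Icc 1 T, u t :=
          mul_le_mul hcard hsub (Finset.sum_nonneg fun t _ => hu0 t) (Nat.cast_nonneg T)
      _ ≤ T * (2 * d * Real.log (1 + T * L ^ 2 / (d * lam))) := by gcongr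
      _ = 2 * d * T * Real.log (1 + T * L ^ 2 / (d * lam)) := by ring
  rw [div_mul_eq_mul_div, le_div_iff₀ hΔ]
  exact hgaps.trans (by gcongr)
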